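/- arXiv:2311.16281 — 2 statements merged into one kernel-verified Lean document; each statement's English description precedes it below -/
import Mathlib

section
/- For positive integers $m, n, \nu$, the double series $Y_{m,n}^{(\nu)} = \sum_{m \mid i} \sum_{mn \mid ij} \frac{\mu(j)}{i^{\nu+1} j \varphi(ij)}$ converges and equals $\frac{S^{(\nu)}}{m^{\nu+2} n^{\nu+2}} \prod_{p \mid n} \frac{-p^{\nu+3}(p^\nu - 1)}{p^{\nu+3} - p^{\nu+2} - p^{\nu+1} + 1} \prod_{p \mid m, p \nmid n} \frac{p^{\nu+1}(p^2-1)}{p^{\nu+3} - p^{\nu+2} - p^{\nu+1} + 1}$, where $S^{(\nu)} = \prod_p \left(1 - \frac{p^\nu - 1}{p-1} \cdot \frac{p}{p^{\nu+2} - 1}\right)$. -/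
open Finset

lemma odd_tot (n : ℕ) : Odd n → n ≤ (Nat.totient n) ^ 2 := by
  induction n using Nat.recOnPosPrimePosCoprime with
  | zero => simp
  | one => simp
  | prime_pow p k hp hk =>
    intro ho
    have h3 : 3 ≤ p := by
      rcases hp.two_le.eq_or_lt with h | h
      · subst h
        exact absurd ho (by simp [Nat.not_odd_iff_even, Nat.even_pow]; omega)
      · exact h
    obtain ⟨k, rfl⟩ : ∃ l, k = l + 1 := ⟨k - 1, by omega⟩
    rw [Nat.totient_prime_pow_succ hp]
    obtain ⟨q, rfl⟩ : ∃ q, p = q + 1 := ⟨p - 1, by omega⟩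
    simp only [Nat.add_sub_cancel]
    have h1 : 1 ≤ (q+1)^k := Nat.one_le_pow _ _ (by omega)
    have h2 : q + 1 ≤ q^2 := by nlinarith
    calc (q+1)^(k+1) = (q+1)^k * (q+1) := pow_succ _ _
      _ ≤ (q+1)^k * q^2 := Nat.mul_le_mul_left _ h2
      _ ≤ ((q+1)^k * (q+1)^k) * q^2 := Nat.mul_le_mul_right _ (by nlinarith)
      _ = _ := by ring
  | coprime a b ha hb hab iha ihb =>
    intro ho
    rw [Nat.totient_mul hab, mul_pow]
    rw [Nat.odd_mul] at ho
    exact Nat.mul_le_mul (iha ho.1) (ihb ho.2)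

lemma tot_bound (n : ℕ) : n ≤ 2 * (Nat.totient n) ^ 2 := by
  rcases Nat.eq_zero_or_pos n with rfl | hn
  · simp
  obtain ⟨k, m, hm, rfl⟩ := Nat.exists_eq_two_pow_mul_odd hn.ne'
  have hc : Nat.Coprime (2^k) m := Nat.Coprime.pow_left _ (Nat.coprime_two_left.2 hm)
  rw [Nat.totient_mul hc, mul_pow, ← mul_assoc]
  refine Nat.mul_le_mul ?_ (odd_tot m hm)
  rcases k with _ | k
  · simp
  · rw [Nat.totient_prime_pow_succ Nat.prime_two]
    have h1 : 1 ≤ 2^k := Nat.one_le_pow _ _ (by omega)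
    simp only [pow_succ]
    nlinarith

lemma summ_jphi : Summable (fun j : ℕ => 1 / ((j:ℝ) * (Nat.totient j : ℝ))) := by
  have h : Summable (fun j : ℕ => 2 * (1 / (j:ℝ) ^ (3/2 : ℝ))) :=
    (Real.summable_one_div_nat_rpow.2 (by norm_num)).mul_left 2
  refine Summable.of_nonneg_of_le (fun j => by positivity) (fun j => ?_) h
  rcases Nat.eq_zero_or_pos j with rfl | hj
  · simp
  have hj' : (0:ℝ) < j := by exact_mod_cast hj
  have hp : (0:ℝ) < Nat.totient j := by exact_mod_cast Nat.totient_pos.2 hj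
  have hb : (j:ℝ) ≤ 2 * (Nat.totient j : ℝ)^2 := by exact_mod_cast tot_bound j
  have hs : (j:ℝ)^(3/2:ℝ) = j * Real.sqrt j := by
    rw [Real.sqrt_eq_rpow, show (3/2:ℝ) = 1 + 1/2 by norm_num, Real.rpow_add hj', Real.rpow_one]
  have hs2 : Real.sqrt j ≤ 2 * Nat.totient j := by
    apply Real.sqrt_le_iff.2
    constructor
    · positivity
    · nlinarith
  rw [hs, mul_one_div, div_le_div_iff₀ (by positivity) (by positivity)]
  nlinarith

lemma mob_sum (ν M : ℕ) (hM : M ≠ 0) :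
    ∑ j ∈ M.divisors, (ArithmeticFunction.moebius j : ℝ) * (j:ℝ)^ν
      = ∏ p ∈ M.primeFactors, (1 - (p:ℝ)^ν) := by
  have h1 : ∑ j ∈ M.divisors, (ArithmeticFunction.moebius j : ℝ) * (j:ℝ)^ν
     = ∑ j ∈ M.divisors with Squarefree j, (ArithmeticFunction.moebius j : ℝ) * (j:ℝ)^ν := by
    rw [Finset.sum_filter]
    refine Finset.sum_congr rfl fun j _ => ?_
    split_ifs with h
    · rfl
    · simp [ArithmeticFunction.moebius_eq_zero_of_not_squarefree h]
  rw [h1, Nat.sum_divisors_filter_squarefree hM]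
  simp only [sub_eq_add_neg]
  rw [Finset.prod_one_add]
  refine Finset.sum_congr ?_ ?_
  · congr 1
    ext p
    simp [Nat.factors_eq]
  · intro t ht
    have ht' : ∀ p ∈ t, p.Prime := by
      intro p hp
      have := Finset.mem_powerset.1 ht hp
      exact Nat.prime_of_mem_primeFactors this
    have e : t.val.prod = ∏ p ∈ t, p := t.prod_val
    rw [e, ArithmeticFunction.isMultiplicative_moebius.map_prod_of_prime t ht']
    push_cast
    rw [← Finset.prod_pow, ← Finset.prod_mul_distrib]
    refine Finset.prod_congr rfl fun p hp => ?_
    rw [ArithmeticFunction.moebius_apply_prime (ht' p hp)]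
    simp

lemma tot_real (n : ℕ) :
    (Nat.totient n : ℝ) = n * ∏ p ∈ n.primeFactors, (1 - (p : ℝ)⁻¹) := by
  have := congrArg (fun x : ℚ => (x : ℝ)) (Nat.totient_eq_mul_prod_factors n)
  push_cast at this
  exact this

noncomputable def cc (m n ν p : ℕ) : ℝ :=
  (if p ∣ n then 1 else 1 - (p:ℝ)^ν) * (if p ∣ m * n then 1 else (1 - (p:ℝ)⁻¹)⁻¹)

noncomputable def GG (m n ν K : ℕ) : ℝ :=
  (∏ p ∈ K.primeFactors, cc m n ν p) / (K:ℝ)^(ν+2)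

lemma pinv {p : ℕ} (hp : p.Prime) : 0 < 1 - (p:ℝ)⁻¹ ∧ 1 - (p:ℝ)⁻¹ ≤ 1 := by
  have : (1:ℝ) < p := by exact_mod_cast hp.one_lt
  have h := inv_lt_one_of_one_lt₀ this
  have h2 : (0:ℝ) < (p:ℝ)⁻¹ := by positivity
  constructor <;> linarith

lemma cc_bound (m n ν p : ℕ) (hp : p.Prime) :
    |cc m n ν p| ≤ (p:ℝ)^ν * (1 - (p:ℝ)⁻¹)⁻¹ := by
  have h1 : (1:ℝ) ≤ (p:ℝ)^ν := one_le_pow₀ (by exact_mod_cast hp.one_lt.le)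
  obtain ⟨h2, h3⟩ := pinv hp
  have h4 : 1 ≤ (1 - (p:ℝ)⁻¹)⁻¹ := (one_le_inv₀ h2).2 h3
  rw [cc, abs_mul]
  refine mul_le_mul ?_ ?_ (abs_nonneg _) (by positivity)
  · split_ifs
    · simpa using h1
    · rw [abs_le]; constructor <;> linarith
  · split_ifs
    · simpa using h4
    · rw [abs_of_pos (by positivity)]

lemma GG_zero (m n ν : ℕ) : GG m n ν 0 = 0 := by simp [GG]
lemma GG_one (m n ν : ℕ) : GG m n ν 1 = 1 := by simp [GG]
lemma GG_mul (m n ν : ℕ) {a b : ℕ} (h : a.Coprime b) :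
    GG m n ν (a * b) = GG m n ν a * GG m n ν b := by
  rw [GG, h.primeFactors_mul, Finset.prod_union h.disjoint_primeFactors, GG, GG]
  push_cast
  rw [mul_pow, mul_div_mul_comm]

lemma GG_summ (m n ν : ℕ) : Summable (fun K => ‖GG m n ν K‖) := by
  refine Summable.of_nonneg_of_le (fun j => by positivity) (fun K => ?_) summ_jphi
  rcases Nat.eq_zero_or_pos K with rfl | hK
  · simp [GG]
  have hK' : (0:ℝ) < K := by exact_mod_cast hK
  rw [tot_real, GG, Real.norm_eq_abs, abs_div, Finset.abs_prod, abs_of_pos (by positivity : (0:ℝ) < (K:ℝ)^(ν+2))]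
  have hpos : 0 < ∏ p ∈ K.primeFactors, (1 - (p : ℝ)⁻¹) :=
    Finset.prod_pos fun p hp => (pinv (Nat.prime_of_mem_primeFactors hp)).1
  have h1 : ∏ p ∈ K.primeFactors, |cc m n ν p| ≤
      (K:ℝ)^ν * (∏ p ∈ K.primeFactors, (1 - (p : ℝ)⁻¹))⁻¹ := by
    calc _ ≤ ∏ p ∈ K.primeFactors, ((p:ℝ)^ν * (1 - (p:ℝ)⁻¹)⁻¹) :=
          Finset.prod_le_prod (fun _ _ => abs_nonneg _)
            fun p hp => cc_bound m n ν p (Nat.prime_of_mem_primeFactors hp)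
      _ = (∏ p ∈ K.primeFactors, (p:ℝ))^ν * (∏ p ∈ K.primeFactors, (1 - (p : ℝ)⁻¹))⁻¹ := by
          rw [Finset.prod_mul_distrib, Finset.prod_pow, Finset.prod_inv_distrib]
      _ ≤ _ := by
          gcongr
          rw [← Nat.cast_prod]
          exact_mod_cast Nat.le_of_dvd hK (Nat.prod_primeFactors_dvd K)
  rw [div_le_iff₀ (by positivity)]
  refine h1.trans (le_of_eq ?_)
  generalize (∏ p ∈ K.primeFactors, (1 - (p : ℝ)⁻¹)) = P at hpos
  field_simp
  ring

/-- local factor -/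
noncomputable def EE (m n ν p : ℕ) : ℝ := 1 + cc m n ν p / ((p:ℝ)^(ν+2) - 1)

lemma pbig {p : ℕ} (hp : p.Prime) (k : ℕ) (hk : k ≠ 0) : (1:ℝ) < (p:ℝ)^k :=
  one_lt_pow₀ (by exact_mod_cast hp.one_lt) hk

lemma GG_pow (m n ν p e : ℕ) (hp : p.Prime) :
    GG m n ν (p ^ (e+1)) = cc m n ν p * ((p:ℝ)^(ν+2))⁻¹ * (((p:ℝ)^(ν+2))⁻¹)^e := by
  rw [GG, Nat.primeFactors_prime_pow (by omega) hp, Finset.prod_singleton, Nat.cast_pow,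
    ← pow_mul, mul_comm (e+1), pow_mul, pow_succ, div_eq_mul_inv, mul_inv, inv_pow]
  ring

lemma geo (c x : ℝ) (hx : 1 < x) (f : ℕ → ℝ) (h0 : f 0 = 1)
    (h : ∀ e, f (e+1) = c * x⁻¹ * (x⁻¹)^e) : ∑' e, f e = 1 + c / (x - 1) := by
  have h1 : HasSum (fun e : ℕ => f (e+1)) (c * x⁻¹ * (1 - x⁻¹)⁻¹) := by
    simp only [h]
    exact (hasSum_geometric_of_lt_one (by positivity) (inv_lt_one_of_one_lt₀ hx)).mul_left _
  have h2 := (hasSum_nat_add_iff 1).1 h1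
  rw [h2.tsum_eq, Finset.sum_range_one, h0]
  have h3 : x - 1 ≠ 0 := by linarith
  have hx0 : x ≠ 0 := by linarith
  have h4 : (1 - x⁻¹)⁻¹ = x / (x - 1) := by
    rw [show 1 - x⁻¹ = (x-1)/x by field_simp, inv_div]
  rw [h4]
  field_simp
  ring

lemma GG_local (m n ν p : ℕ) (hp : p.Prime) :
    ∑' e, GG m n ν (p ^ e) = EE m n ν p :=
  geo _ _ (pbig hp (ν+2) (by omega)) (fun e => GG m n ν (p ^ e)) (by simp [GG_one])
    (fun e => GG_pow m n ν p e hp)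

lemma GG_prod (m n ν : ℕ) :
    HasProd (fun p : Nat.Primes => EE m n ν p) (∑' K, GG m n ν K) := by
  have := EulerProduct.eulerProduct_hasProd (GG_one m n ν) (GG_mul m n ν) (GG_summ m n ν) (GG_zero m n ν)
  have e : (fun p : Nat.Primes => EE m n ν p) = fun p : Nat.Primes => ∑' e, GG m n ν ((p:ℕ) ^ e) :=
    funext fun p => (GG_local _ _ _ _ p.2).symm
  rw [e]
  exact this

noncomputable def DD (ν p : ℕ) : ℝ :=
  (p : ℝ) ^ (ν + 3) - (p : ℝ) ^ (ν + 2) - (p : ℝ) ^ (ν + 1) + 1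

lemma DD_pos (ν p : ℕ) (hp : p.Prime) : 0 < DD ν p := by
  have h2 : (2:ℝ) ≤ p := by exact_mod_cast hp.two_le
  have : DD ν p = (p:ℝ)^(ν+1) * ((p:ℝ)^2 - p - 1) + 1 := by rw [DD]; ring
  rw [this]
  have : 0 ≤ (p:ℝ)^2 - p - 1 := by nlinarith
  positivity

lemma LL_eq (ν p : ℕ) (hp : p.Prime) :
    EE 1 1 ν p = 1 - ((p:ℝ) ^ ν - 1) / ((p : ℝ) - 1) * ((p : ℝ) / ((p : ℝ) ^ (ν + 2) - 1)) := by
  have hx := pbig hp (ν+2) (by omega)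
  have h2 : (2:ℝ) ≤ p := by exact_mod_cast hp.two_le
  have h3 : (p:ℝ) - 1 ≠ 0 := by linarith
  have h4 : (p : ℝ) ^ (ν + 2) - 1 ≠ 0 := by linarith
  have h5 : (1 - (p:ℝ)⁻¹)⁻¹ = p / (p - 1) := by field_simp
  have h6 : ¬ p ∣ 1 := hp.not_dvd_one
  simp only [EE, cc, mul_one, h6, if_false, h5]
  field_simp
  ring

lemma LL_D (ν p : ℕ) (hp : p.Prime) :
    EE 1 1 ν p = DD ν p / (((p:ℝ) - 1) * ((p : ℝ) ^ (ν + 2) - 1)) := by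
  rw [LL_eq ν p hp, DD]
  have hx := pbig hp (ν+2) (by omega)
  have h2 : (2:ℝ) ≤ p := by exact_mod_cast hp.two_le
  have h3 : (p:ℝ) - 1 ≠ 0 := by linarith
  have h4 : (p : ℝ) ^ (ν + 2) - 1 ≠ 0 := by linarith
  field_simp
  ring

lemma LL_ne (ν p : ℕ) (hp : p.Prime) : EE 1 1 ν p ≠ 0 := by
  rw [LL_D ν p hp]
  have hx := pbig hp (ν+2) (by omega)
  have h2 : (2:ℝ) ≤ p := by exact_mod_cast hp.two_le
  have h3 : (p:ℝ) - 1 ≠ 0 := by linarith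
  have h4 : (p : ℝ) ^ (ν + 2) - 1 ≠ 0 := by linarith
  have := (DD_pos ν p hp).ne'
  positivity

lemma GG_sum (m n ν : ℕ) (hm : 0 < m) (hn : 0 < n) :
    ∑' K, GG m n ν K = (∏' q : Nat.Primes, EE 1 1 ν q) *
      ∏ p ∈ (m * n).primeFactors, (EE m n ν p / EE 1 1 ν p) := by
  have h1 := GG_prod 1 1 ν
  let s : Finset Nat.Primes := (m * n).primeFactors.attach.image
    (fun p => (⟨p.1, Nat.prime_of_mem_primeFactors p.2⟩ : Nat.Primes))
  have hs : ∀ q : Nat.Primes, q ∈ s ↔ (q : ℕ) ∣ m * n := by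
    intro q
    refine Finset.mem_image.trans ?_
    constructor
    · rintro ⟨a, _, rfl⟩
      exact Nat.dvd_of_mem_primeFactors a.2
    · intro h
      exact ⟨⟨q.1, Nat.mem_primeFactors.2 ⟨q.2, h, by positivity⟩⟩, Finset.mem_attach _ _, rfl⟩
  have h2 : HasProd (fun q : Nat.Primes => EE m n ν q / EE 1 1 ν q)
      (∏ q ∈ s, (EE m n ν q / EE 1 1 ν q)) := by
    apply hasProd_prod_of_ne_finset_one
    intro q hq
    rw [hs] at hq
    have hq2 : ¬ (q:ℕ) ∣ n := fun h => hq (h.mul_left m)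
    have : cc m n ν q = cc 1 1 ν q := by
      simp [cc, hq, hq2, q.2.one_lt.ne']
    rw [EE, this, ← EE, div_self (LL_ne ν q q.2)]
  have h3 := h1.mul h2
  have e : (fun q : Nat.Primes => EE 1 1 ν q * (EE m n ν q / EE 1 1 ν q)) =
      fun q : Nat.Primes => EE m n ν q := by
    funext q
    have := LL_ne ν q q.2
    field_simp
  have h4 := h3
  rw [e] at h4
  rw [(GG_prod m n ν).unique h4, h1.tprod_eq]
  congr 1
  refine Finset.prod_bij (fun q _ => q.1) ?_ ?_ ?_ ?_
  · intro q hq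
    exact Nat.mem_primeFactors.2 ⟨q.2, (hs q).1 hq, by positivity⟩
  · intro a _ b _ h
    exact Subtype.ext h
  · intro p hp
    exact ⟨⟨p, Nat.prime_of_mem_primeFactors hp⟩, (hs _).2 (Nat.dvd_of_mem_primeFactors hp), rfl⟩
  · intro q _
    rfl

lemma prod_split (a : ℕ → ℝ) (N K : ℕ) (hN : N ≠ 0) (hK : K ≠ 0) :
    ∏ p ∈ (N * K).primeFactors, a p =
      (∏ p ∈ N.primeFactors, a p) * ∏ p ∈ K.primeFactors, (if p ∣ N then 1 else a p) := by
  rw [Nat.primeFactors_mul hN hK, ← Finset.union_sdiff_self_eq_union,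
    Finset.prod_union Finset.disjoint_sdiff]
  congr 1
  have : K.primeFactors \ N.primeFactors = K.primeFactors.filter (fun p => ¬ p ∣ N) := by
    ext p
    simp only [Finset.mem_sdiff, Finset.mem_filter, Nat.mem_primeFactors]
    tauto
  rw [this, Finset.prod_filter]
  refine Finset.prod_congr rfl fun p _ => ?_
  split_ifs <;> simp_all

noncomputable def ff (m n ν : ℕ) (p : ℕ × ℕ) : ℝ :=
      if 0 < p.1 ∧ 0 < p.2 ∧ m ∣ p.1 ∧ m * n ∣ p.1 * p.2 then
        (ArithmeticFunction.moebius p.2 : ℝ) /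
          ((p.1 : ℝ) ^ (ν + 1) * (p.2 : ℝ) * (Nat.totient (p.1 * p.2) : ℝ))
      else 0

lemma ff_summ (m n ν : ℕ) (hν : 0 < ν) : Summable (ff m n ν) := by
  have h1 : Summable (fun i : ℕ => 1 / (i:ℝ)^2) := Real.summable_one_div_nat_pow.2 (by norm_num)
  have h2 := h1.mul_of_nonneg summ_jphi (fun i => by positivity) (fun i => by positivity)
  refine Summable.of_norm_bounded h2 ?_
  rintro ⟨i, j⟩
  simp only [ff]
  split_ifs with h
  · obtain ⟨hi, hj, -, -⟩ := h
    have hi' : (1:ℝ) ≤ i := by exact_mod_cast hi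
    have hj' : (0:ℝ) < j := by exact_mod_cast hj
    have ht : (Nat.totient j : ℝ) ≤ Nat.totient (i * j) := by
      exact_mod_cast Nat.le_of_dvd (Nat.totient_pos.2 (by positivity))
        (Nat.totient_dvd_of_dvd (Dvd.intro_left i rfl))
    have ht0 : (0:ℝ) < Nat.totient j := by exact_mod_cast Nat.totient_pos.2 hj
    have hmu : |(ArithmeticFunction.moebius j : ℝ)| ≤ 1 := by
      exact_mod_cast ArithmeticFunction.abs_moebius_le_one
    rw [Real.norm_eq_abs, abs_div, div_mul_div_comm, one_mul]
    refine div_le_div₀ (by norm_num) hmu (by positivity) ?_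
    rw [abs_of_nonneg (by positivity), ← mul_assoc]
    have : (i:ℝ)^2 ≤ (i:ℝ)^(ν+1) := pow_le_pow_right₀ hi' (by omega)
    gcongr
  · simp only [norm_zero]
    positivity

noncomputable def CC (m n ν : ℕ) : ℝ :=
  (∏ p ∈ n.primeFactors, (1 - (p:ℝ)^ν)) * (∏ p ∈ (m*n).primeFactors, (1 - (p:ℝ)⁻¹))⁻¹ /
    ((m:ℝ)^(ν+2) * (n:ℝ)^(ν+2))

lemma fiber_sum (m n ν K : ℕ) (hm : 0 < m) (hn : 0 < n) (hK : 0 < K) :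
    ∑ x ∈ (m * n * K).divisorsAntidiagonal, ff m n ν x = CC m n ν * GG m n ν K := by
  have hN : 0 < m * n * K := by positivity
  have h1 := Nat.sum_divisorsAntidiagonal' (fun i j => ff m n ν (i, j)) (n := m * n * K)
  simp only [Prod.mk.eta] at h1
  rw [h1]
  have hsub : (n * K).divisors ⊆ (m * n * K).divisors :=
    Nat.divisors_subset_of_dvd hN.ne' ⟨m, by ring⟩
  rw [← Finset.sum_subset hsub]
  · have h2 : ∀ j ∈ (n * K).divisors, ff m n ν (m * n * K / j, j) =
        (((m * n * K : ℕ) : ℝ)^(ν+1) * (Nat.totient (m * n * K) : ℝ))⁻¹ *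
          ((ArithmeticFunction.moebius j : ℝ) * (j:ℝ)^ν) := by
      intro j hj
      obtain ⟨l, hl⟩ := Nat.dvd_of_mem_divisors hj
      have hj0 : 0 < j := Nat.pos_of_mem_divisors hj
      have hl0 : 0 < l := by
        rcases Nat.eq_zero_or_pos l with rfl | h
        · have : 0 < n * K := by positivity
          omega
        · exact h
      have hNe : m * n * K = m * l * j := by rw [mul_assoc, hl]; ring
      have hd : m * n * K / j = m * l := by rw [hNe, Nat.mul_div_cancel _ hj0]
      have hc : 0 < m * l ∧ 0 < j ∧ m ∣ m * l ∧ m * n ∣ m * l * j :=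
        ⟨by positivity, hj0, Dvd.intro _ rfl, by rw [← hNe]; exact Dvd.intro _ rfl⟩
      simp only [ff]
      rw [hd, if_pos hc, hNe]
      have hj' : (0:ℝ) < j := by exact_mod_cast hj0
      have hl' : (0:ℝ) < l := by exact_mod_cast hl0
      have hm' : (0:ℝ) < m := by exact_mod_cast hm
      have ht : (0:ℝ) < Nat.totient (m * l * j) := by
        exact_mod_cast Nat.totient_pos.2 (by positivity)
      push_cast
      field_simp
      ring
    rw [Finset.sum_congr rfl h2, ← Finset.mul_sum, mob_sum ν _ (by positivity), tot_real,
      prod_split _ n K hn.ne' hK.ne', prod_split _ (m*n) K (by positivity) hK.ne', CC, GG]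
    simp only [cc]
    rw [Finset.prod_mul_distrib]
    have h3 : ∏ p ∈ K.primeFactors, (if p ∣ m * n then (1:ℝ) else (1 - (p:ℝ)⁻¹)⁻¹) =
        (∏ p ∈ K.primeFactors, (if p ∣ m * n then (1:ℝ) else (1 - (p:ℝ)⁻¹)))⁻¹ := by
      rw [← Finset.prod_inv_distrib]
      refine Finset.prod_congr rfl fun p _ => ?_
      split_ifs <;> simp
    rw [h3]
    generalize (∏ p ∈ K.primeFactors, (if p ∣ m * n then (1:ℝ) else (1 - (p:ℝ)⁻¹))) = A
    generalize (∏ p ∈ K.primeFactors, (if p ∣ n then (1:ℝ) else (1 - (p:ℝ)^ν))) = B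
    generalize (∏ p ∈ (m*n).primeFactors, (1 - (p:ℝ)⁻¹)) = C
    generalize (∏ p ∈ n.primeFactors, (1 - (p:ℝ)^ν)) = D
    push_cast
    simp only [div_eq_mul_inv, mul_inv, mul_pow]
    ring
  · intro j hj hj2
    have hj0 : 0 < j := Nat.pos_of_mem_divisors hj
    simp only [ff]
    rw [if_neg]
    rintro ⟨-, -, ⟨l, hl⟩, -⟩
    apply hj2
    refine Nat.mem_divisors.2 ⟨⟨l, ?_⟩, by positivity⟩
    have := Nat.div_mul_cancel (Nat.dvd_of_mem_divisors hj)
    rw [hl] at this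
    apply Nat.eq_of_mul_eq_mul_left hm
    rw [← mul_assoc, ← this]; ring

lemma fiber_tsum (m n ν N : ℕ) (hN : N ≠ 0) :
    ∑' b : ((fun p : ℕ × ℕ => p.1 * p.2) ⁻¹' {N}), ff m n ν b =
      ∑ x ∈ N.divisorsAntidiagonal, ff m n ν x := by
  have : ((fun p : ℕ × ℕ => p.1 * p.2) ⁻¹' {N}) = (N.divisorsAntidiagonal : Set (ℕ × ℕ)) := by
    ext x
    simp [hN]
  rw [this]
  exact Finset.tsum_subtype' _ _

lemma ff_tsum (m n ν : ℕ) (hm : 0 < m) (hn : 0 < n) (hν : 0 < ν) :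
    ∑' p, ff m n ν p = CC m n ν * ∑' K, GG m n ν K := by
  have h := (ff_summ m n ν hν).hasSum.tsum_fiberwise (fun p : ℕ × ℕ => p.1 * p.2)
  rw [← h.tsum_eq]
  have h0 : ∀ N, (N = 0 ∨ ¬ m * n ∣ N) →
      ∑' b : ((fun p : ℕ × ℕ => p.1 * p.2) ⁻¹' {N}), ff m n ν b = 0 := by
    intro N hN
    have : ∀ b : ((fun p : ℕ × ℕ => p.1 * p.2) ⁻¹' {N}), ff m n ν b = 0 := by
      rintro ⟨⟨i, j⟩, hb⟩
      have hb' : i * j = N := hb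
      simp only [ff]
      rw [if_neg]
      rintro ⟨hi, hj, -, hd⟩
      rw [hb'] at hd
      rcases hN with hN | hN
      · have := Nat.mul_pos hi hj
        omega
      · exact hN hd
    simp [this]
  have hinj : Function.Injective (fun K : ℕ => m * n * K) := fun a b hab =>
    Nat.eq_of_mul_eq_mul_left (by positivity : 0 < m * n) hab
  rw [← hinj.tsum_eq, ← tsum_mul_left]
  · refine tsum_congr fun K => ?_
    rcases Nat.eq_zero_or_pos K with rfl | hK
    · rw [h0 _ (Or.inl (mul_zero _)), GG_zero, mul_zero]
    · rw [fiber_tsum _ _ _ _ (by positivity), fiber_sum m n ν K hm hn hK]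
  · intro N hN
    by_contra hc
    apply hN
    refine h0 N (Or.inr ?_)
    rintro ⟨K, rfl⟩
    exact hc ⟨K, rfl⟩

lemma factor_n (m n ν p : ℕ) (hp : p.Prime) (h : p ∣ n) :
    (1 - (p:ℝ)^ν) * ((1 - (p:ℝ)⁻¹)⁻¹ * (EE m n ν p / EE 1 1 ν p)) =
      (-(p : ℝ) ^ (ν + 3) * ((p : ℝ) ^ ν - 1)) / DD ν p := by
  have hx := pbig hp (ν+2) (by omega)
  have h2 : (2:ℝ) ≤ p := by exact_mod_cast hp.two_le
  have h3 : (p:ℝ) - 1 ≠ 0 := by linarith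
  have h4 : (p : ℝ) ^ (ν + 2) - 1 ≠ 0 := by linarith
  have h5 : (1 - (p:ℝ)⁻¹)⁻¹ = p / (p - 1) := by field_simp
  have hD := (DD_pos ν p hp).ne'
  rw [LL_D ν p hp, h5]
  simp only [EE, cc, h, h.mul_left m, if_true]
  field_simp
  ring

lemma factor_m (m n ν p : ℕ) (hp : p.Prime) (h : p ∣ m) (hn : ¬ p ∣ n) :
    (1 - (p:ℝ)⁻¹)⁻¹ * (EE m n ν p / EE 1 1 ν p) =
      ((p : ℝ) ^ (ν + 1) * ((p : ℝ) ^ 2 - 1)) / DD ν p := by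
  have hx := pbig hp (ν+2) (by omega)
  have h2 : (2:ℝ) ≤ p := by exact_mod_cast hp.two_le
  have h3 : (p:ℝ) - 1 ≠ 0 := by linarith
  have h4 : (p : ℝ) ^ (ν + 2) - 1 ≠ 0 := by linarith
  have h5 : (1 - (p:ℝ)⁻¹)⁻¹ = p / (p - 1) := by field_simp
  have hD := (DD_pos ν p hp).ne'
  rw [LL_D ν p hp, h5]
  simp only [EE, cc, hn, h.mul_right n, if_true, if_false]
  field_simp
  ring

theorem stmt9 (m n ν : ℕ) (hm : 0 < m) (hn : 0 < n) (hν : 0 < ν) :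
    Summable (fun p : ℕ × ℕ =>
      if 0 < p.1 ∧ 0 < p.2 ∧ m ∣ p.1 ∧ m * n ∣ p.1 * p.2 then
        (ArithmeticFunction.moebius p.2 : ℝ) /
          ((p.1 : ℝ) ^ (ν + 1) * (p.2 : ℝ) * (Nat.totient (p.1 * p.2) : ℝ))
      else 0) ∧
    (∑' p : ℕ × ℕ,
        (if 0 < p.1 ∧ 0 < p.2 ∧ m ∣ p.1 ∧ m * n ∣ p.1 * p.2 then
          (ArithmeticFunction.moebius p.2 : ℝ) /
            ((p.1 : ℝ) ^ (ν + 1) * (p.2 : ℝ) * (Nat.totient (p.1 * p.2) : ℝ))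
        else 0)) =
      (∏' q : Nat.Primes,
          (1 - (((q : ℕ) : ℝ) ^ ν - 1) / (((q : ℕ) : ℝ) - 1) *
            (((q : ℕ) : ℝ) / (((q : ℕ) : ℝ) ^ (ν + 2) - 1)))) /
          ((m : ℝ) ^ (ν + 2) * (n : ℝ) ^ (ν + 2)) *
        (∏ p ∈ n.primeFactors,
          (-(p : ℝ) ^ (ν + 3) * ((p : ℝ) ^ ν - 1)) /
            ((p : ℝ) ^ (ν + 3) - (p : ℝ) ^ (ν + 2) - (p : ℝ) ^ (ν + 1) + 1)) *
        (∏ p ∈ m.primeFactors \ n.primeFactors,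
          ((p : ℝ) ^ (ν + 1) * ((p : ℝ) ^ 2 - 1)) /
            ((p : ℝ) ^ (ν + 3) - (p : ℝ) ^ (ν + 2) - (p : ℝ) ^ (ν + 1) + 1)) := by
  refine ⟨ff_summ m n ν hν, ?_⟩
  change ∑' p, ff m n ν p = _
  rw [ff_tsum m n ν hm hn hν, GG_sum m n ν hm hn]
  have hS : (∏' q : Nat.Primes, EE 1 1 ν q) = ∏' q : Nat.Primes,
          (1 - (((q : ℕ) : ℝ) ^ ν - 1) / (((q : ℕ) : ℝ) - 1) *
            (((q : ℕ) : ℝ) / (((q : ℕ) : ℝ) ^ (ν + 2) - 1))) :=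
    tprod_congr fun q => LL_eq ν q q.2
  rw [← hS]
  generalize (∏' q : Nat.Primes, EE 1 1 ν q) = S
  have hA : (∏ p ∈ n.primeFactors, (1 - (p:ℝ)^ν)) *
      ((∏ p ∈ (m*n).primeFactors, (1 - (p:ℝ)⁻¹))⁻¹ *
        ∏ p ∈ (m * n).primeFactors, (EE m n ν p / EE 1 1 ν p)) =
      (∏ p ∈ n.primeFactors, (-(p : ℝ) ^ (ν + 3) * ((p : ℝ) ^ ν - 1)) / DD ν p) *
      ∏ p ∈ m.primeFactors \ n.primeFactors,
        ((p : ℝ) ^ (ν + 1) * ((p : ℝ) ^ 2 - 1)) / DD ν p := by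
    rw [← Finset.prod_inv_distrib, ← Finset.prod_mul_distrib, Nat.primeFactors_mul hm.ne' hn.ne',
      Finset.union_comm, ← Finset.union_sdiff_self_eq_union,
      Finset.prod_union Finset.disjoint_sdiff, ← mul_assoc, ← Finset.prod_mul_distrib]
    congr 1
    · refine Finset.prod_congr rfl fun p hp => ?_
      exact factor_n m n ν p (Nat.prime_of_mem_primeFactors hp) (Nat.dvd_of_mem_primeFactors hp)
    · refine Finset.prod_congr rfl fun p hp => ?_
      obtain ⟨h1, h2⟩ := Finset.mem_sdiff.1 hp
      have hpp := Nat.prime_of_mem_primeFactors h1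
      exact factor_m m n ν p hpp (Nat.dvd_of_mem_primeFactors h1)
        fun h => h2 (Nat.mem_primeFactors.2 ⟨hpp, h, hn.ne'⟩)
  simp only [DD] at hA
  rw [mul_assoc (S / _), ← hA, CC]
  ring
end

section
/- Let $a, b_1, \ldots, b_\nu \in \mathbb{Q}^*_{>0}$ be multiplicatively independent, and for positive integers $i, j$ let $F_{i,j} = \mathbb{Q}(\zeta_{ij}, a^{1/ij}, b_1^{1/i}, \ldots, b_\nu^{1/i})$. Then $[F_{i,j} : \mathbb{Q}]$ divides $i^{\nu+1} j \varphi(ij)$ and the quotient $\frac{i^{\nu+1} j \varphi(ij)}{[F_{i,j} : \mathbb{Q}]}$ divides $2^{\nu+1} m_a \prod_{h=1}^\nu m_{b_h}$. -/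
open IntermediateField

/-- `mRoot x` is the largest `m` such that `x` has a positive rational `m`-th root. -/
noncomputable def mRoot (x : ℚ) : ℕ :=
  sSup {m : ℕ | ∃ y : ℚ, 0 < y ∧ y ^ m = x}

lemma mRoot_bdd (c : ℚ) (hc : 0 < c) (hc1 : c ≠ 1) :
    BddAbove {m : ℕ | ∃ y : ℚ, 0 < y ∧ y ^ m = c} := by
  refine ⟨max c.num.natAbs c.den, ?_⟩
  rintro m ⟨y, hy, rfl⟩
  rw [Rat.num_pow, Rat.den_pow, Int.natAbs_pow]
  have key : ∀ t : ℕ, 1 < t → m ≤ t ^ m := fun t ht => (Nat.lt_pow_self ht).le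
  have hn : 0 < y.num := Rat.num_pos.2 hy
  have hd := y.den_pos
  rcases Nat.lt_or_ge 1 y.den with h | h
  · exact le_max_of_le_right (key _ h)
  · rcases Nat.lt_or_ge 1 y.num.natAbs with h' | h'
    · exact le_max_of_le_left (key _ h')
    · exfalso
      apply hc1
      have h1 : y.num = 1 := by omega
      have h2 : y.den = 1 := by omega
      have : y = 1 := by
        rw [← Rat.num_div_den y, h1, h2]; norm_num
      rw [this, one_pow]

lemma dvd_mRoot (c q : ℚ) (hc1 : c ≠ 1) (N : ℕ) (hq : 0 < q) (h : q ^ N = c) :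
    N ∣ mRoot c := by
  have hc : 0 < c := h ▸ pow_pos hq N
  have hb := mRoot_bdd c hc hc1
  have hmem : mRoot c ∈ {m : ℕ | ∃ y : ℚ, 0 < y ∧ y ^ m = c} :=
    Nat.sSup_mem ⟨N, q, hq, h⟩ hb
  have hle : ∀ m, (∃ y : ℚ, 0 < y ∧ y ^ m = c) → m ≤ mRoot c := fun m hm => le_csSup hb hm
  obtain ⟨y, hy, hyM⟩ := hmem
  set M := mRoot c
  have hM : 0 < M := by
    rcases Nat.eq_zero_or_pos M with h0 | h0
    · rw [h0, pow_zero] at hyM; exact absurd hyM.symm hc1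
    · exact h0
  obtain ⟨g, M', N', hg, hcop, rfl', hN'⟩ := Nat.exists_coprime' (m := M) (n := N) (Nat.gcd_pos_of_pos_left _ hM)
  have hbz := Nat.gcd_eq_gcd_ab M' N'
  rw [Nat.Coprime.gcd_eq_one hcop] at hbz
  set u := Nat.gcdA M' N'
  set v := Nat.gcdB M' N'
  have hL : N' * M ≤ M := by
    apply hle
    refine ⟨y ^ v * q ^ u, by positivity, ?_⟩
    have e1 : (y ^ v) ^ (N' * M) = c ^ (N' * v) := by
      rw [← hyM, ← zpow_natCast, ← zpow_natCast, ← zpow_mul, ← zpow_mul]; congr 1; push_cast; ring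
    have e2 : (q ^ u) ^ (N' * M) = c ^ (M' * u) := by
      rw [← h, ← zpow_natCast, ← zpow_natCast, ← zpow_mul, ← zpow_mul]; congr 1; rw [rfl', hN']; push_cast; ring
    rw [mul_pow, e1, e2, ← zpow_add₀ hc.ne']
    rw [show (N' : ℤ) * v + M' * u = 1 by push_cast at hbz; linarith, zpow_one]
  have hN1 : N' ≤ 1 := by nlinarith
  have : N' = 0 ∨ N' = 1 := by omega
  rcases this with h0 | h0
  · rw [h0] at hN'; simp at hN'; rw [hN', pow_zero] at h; exact absurd h.symm hc1
  · rw [hN', rfl', h0, one_mul]; exact Dvd.intro_left _ rfl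

lemma idx_dvd {ι : Type} [Fintype ι] (n d : ι → ℕ) [∀ k, NeZero (n k)]
    (f : (∀ k, rootsOfUnity (n k) ℂ) →* (∀ k, rootsOfUnity (n k) ℂ))
    (hf : ∀ x k, f x k = x k ^ d k) : f.range.index ∣ ∏ k, d k := by
  rw [Subgroup.index_range]
  have e : f.ker ≃ ∀ k, (powMonoidHom (d k) : rootsOfUnity (n k) ℂ →* _).ker :=
    (Equiv.subtypeEquivRight (q := fun x => ∀ k, x k ∈ (powMonoidHom (d k) : rootsOfUnity (n k) ℂ →* _).ker) (fun x => by
      rw [MonoidHom.mem_ker, funext_iff]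
      simp only [MonoidHom.mem_ker, hf, powMonoidHom_apply]; rfl)).trans Equiv.subtypePiEquivPi
  rw [Nat.card_congr e, Nat.card_pi]
  refine Finset.prod_dvd_prod_of_dvd _ _ fun k _ => ?_
  rw [IsCyclic.card_powMonoidHom_ker]
  exact Nat.gcd_dvd_right _ _

lemma char_pow (n : ℕ) [NeZero n] (χ : rootsOfUnity n ℂ →* ℂˣ) :
    ∃ l : ℕ, ∀ x, χ x = (x : ℂˣ) ^ l := by
  obtain ⟨g, hg⟩ := IsCyclic.exists_generator (α := rootsOfUnity n ℂ)
  have hcard : Nat.card (rootsOfUnity n ℂ) = n := by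
    rw [HasEnoughRootsOfUnity.natCard_rootsOfUnity]
  have hord : orderOf g = n := by rw [orderOf_eq_card_of_forall_mem_zpowers hg, hcard]
  have hprim : IsPrimitiveRoot (g : ℂˣ) n := by
    have := IsPrimitiveRoot.orderOf (g : ℂˣ)
    rwa [Subgroup.orderOf_coe, hord] at this
  have hgn : g ^ n = 1 := by
    have := pow_orderOf_eq_one g
    rwa [hord] at this
  have h1 : (χ g) ^ n = 1 := by rw [← map_pow, hgn, map_one]
  have hp : IsPrimitiveRoot ((g : ℂˣ) : ℂ) n := IsPrimitiveRoot.coe_units_iff.2 hprim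
  obtain ⟨l, -, hl⟩ := hp.eq_pow_of_pow_eq_one (ξ := ((χ g : ℂˣ) : ℂ)) (by rw [← Units.val_pow_eq_pow_val, h1, Units.val_one])
  refine ⟨l, fun x => ?_⟩
  obtain ⟨t, rfl⟩ := Subgroup.mem_zpowers_iff.1 (hg x)
  have hl' : (g : ℂˣ) ^ l = χ g := by ext; simpa using hl
  rw [map_zpow, ← hl']
  push_cast
  rw [← zpow_natCast, ← zpow_natCast, zpow_comm]

lemma char_pi {ι : Type} [Fintype ι] (n : ι → ℕ) [∀ k, NeZero (n k)]
    (χ : (∀ k, rootsOfUnity (n k) ℂ) →* ℂˣ) :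
    ∃ l : ι → ℕ, ∀ x, χ x = ∏ k, (x k : ℂˣ) ^ l k := by
  classical
  choose l hl using fun k => char_pow (n k) (χ.comp (MonoidHom.mulSingle (fun k => rootsOfUnity (n k) ℂ) k))
  refine ⟨l, fun x => ?_⟩
  conv_lhs => rw [← Finset.univ_prod_mulSingle x]
  rw [map_prod]
  exact Finset.prod_congr rfl fun k _ => hl k (x k)

lemma sub_of_char {ι : Type} [Fintype ι] (n : ι → ℕ) [∀ k, NeZero (n k)]
    (H : Subgroup (∀ k, rootsOfUnity (n k) ℂ)) (g : ∀ k, rootsOfUnity (n k) ℂ)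
    (h : ∀ l : ι → ℕ, (∀ x ∈ H, ∏ k, (x k : ℂˣ) ^ l k = 1) → ∏ k, (g k : ℂˣ) ^ l k = 1) :
    g ∈ H := by
  by_contra hg
  have hne : (QuotientGroup.mk g : (∀ k, rootsOfUnity (n k) ℂ) ⧸ H) ≠ 1 := by
    rwa [Ne, QuotientGroup.eq_one_iff]
  have : NeZero (Monoid.exponent ((∀ k, rootsOfUnity (n k) ℂ) ⧸ H)) :=
    ⟨Monoid.exponent_ne_zero_of_finite⟩
  obtain ⟨φ, hφ⟩ := CommGroup.exists_apply_ne_one_of_hasEnoughRootsOfUnity _ ℂ hne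
  obtain ⟨l, hl⟩ := char_pi n (φ.comp (QuotientGroup.mk' H))
  apply hφ
  have := h l (fun x hx => by
    rw [← hl x]
    simp [(QuotientGroup.eq_one_iff x).2 hx])
  rw [← hl g] at this
  simpa using this

lemma cyc_ext (N : ℕ) [NeZero N] (ζ : ℂ) (hζ : IsPrimitiveRoot ζ N) :
    IsCyclotomicExtension {N} ℚ (adjoin ℚ {ζ}) := by
  change IsCyclotomicExtension {N} ℚ (IntermediateField.adjoin ℚ {ζ}).toSubalgebra
  rw [IntermediateField.adjoin_simple_toSubalgebra_of_isAlgebraic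
    (IsIntegral.tower_top (hζ.isIntegral (NeZero.pos N))).isAlgebraic]
  exact hζ.adjoin_isCyclotomicExtension ℚ

lemma cyc_real (N : ℕ) [NeZero N] (ζ : ℂ) (hζ : IsPrimitiveRoot ζ N) (y : ℝ)
    (hyK : (y : ℂ) ∈ adjoin ℚ {ζ}) (c : ℚ) (hc : y ^ N = c) : ∃ q : ℚ, y ^ 2 = q := by
  have := cyc_ext N ζ hζ
  have hab : IsAbelianGalois ℚ (adjoin ℚ {ζ}) := IsCyclotomicExtension.isAbelianGalois {N} ℚ _
  have hfd : FiniteDimensional ℚ (adjoin ℚ {ζ}) := IsCyclotomicExtension.finiteDimensional {N} ℚ _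
  set K := adjoin ℚ {ζ}
  let Y : K := ⟨y, hyK⟩
  let τ : K ≃ₐ[ℚ] K := (Complex.conjAe.restrictScalars ℚ).restrictNormal K
  have hτ : ∀ x : K, ((τ x : K) : ℂ) = (starRingEnd ℂ) (x : ℂ) := fun x =>
    AlgEquiv.restrictNormal_commutes (Complex.conjAe.restrictScalars ℚ) K x
  have hτY : τ Y = Y := by
    apply Subtype.ext; rw [hτ]; exact Complex.conj_ofReal y
  have hfix : ∀ σ : K ≃ₐ[ℚ] K, σ (Y ^ 2) = Y ^ 2 := by
    intro σ
    have hcomm : τ (σ Y) = σ Y := by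
      have : τ * σ = σ * τ := mul_comm' τ σ
      have h2 := congrArg (fun f : K ≃ₐ[ℚ] K => f Y) this
      simpa [hτY] using h2
    obtain ⟨r, hr⟩ := Complex.conj_eq_iff_real.1 ((hτ (σ Y)).symm.trans (congrArg _ hcomm))
    have hYN : Y ^ N = algebraMap ℚ K c := by
      apply Subtype.ext
      change (y : ℂ) ^ N = ((algebraMap ℚ K c : K) : ℂ)
      have : (y : ℂ) ^ N = ((c : ℝ) : ℂ) := by rw [← hc]; push_cast; rfl
      rw [this]; simp
    have h3 : (σ Y) ^ N = Y ^ N := by rw [← map_pow, hYN, AlgEquiv.commutes]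
    have h4 : r ^ N = y ^ N := by
      have := congrArg (Subtype.val) h3
      have h5 : ((σ Y : K) : ℂ) ^ N = (y : ℂ) ^ N := this
      rw [hr] at h5
      exact_mod_cast h5
    have h6 : |r| = |y| := by
      have := congrArg abs h4
      rw [abs_pow, abs_pow] at this
      exact (pow_left_inj₀ (abs_nonneg _) (abs_nonneg _) (NeZero.ne N)).1 this
    have h7 : r ^ 2 = y ^ 2 := sq_eq_sq_iff_abs_eq_abs _ _ |>.2 h6
    rw [map_pow]
    apply Subtype.ext
    change ((σ Y : K) : ℂ) ^ 2 = (y : ℂ) ^ 2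
    rw [hr]; exact_mod_cast h7
  have hbot := (IsGalois.mem_bot_iff_fixed (F := ℚ) (Y ^ 2)).2 hfix
  obtain ⟨q, hq⟩ := IntermediateField.mem_bot.1 hbot
  refine ⟨q, ?_⟩
  have := congrArg Subtype.val hq
  have h8 : (q : ℂ) = (y : ℂ) ^ 2 := by
    rw [← show ((algebraMap ℚ K q : K) : ℂ) = (q : ℂ) by simp]; exact this
  exact_mod_cast h8.symm

lemma kum_hom (K : IntermediateField ℚ ℂ) (F : IntermediateField K ℂ) (n : ℕ) [NeZero n]
    (hroots : ∀ z : ℂ, z ^ n = 1 → z ∈ K) (r : F) (hr : r ≠ 0) (c : K)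
    (hc : r ^ n = algebraMap K F c) :
    ∃ φ : (F ≃ₐ[K] F) →* rootsOfUnity n ℂ,
      ∀ σ : F ≃ₐ[K] F, ((σ r : F) : ℂ) = ((φ σ : ℂˣ) : ℂ) * (r : ℂ) := by
  have hrC : (r : ℂ) ≠ 0 := fun h => hr (Subtype.ext h)
  have hσ0 : ∀ σ : F ≃ₐ[K] F, ((σ r : F) : ℂ) / r ≠ 0 := fun σ =>
    div_ne_zero (fun h => hr ((map_eq_zero σ).1 (Subtype.ext h))) hrC
  have hpow : ∀ σ : F ≃ₐ[K] F, (((σ r : F) : ℂ) / r) ^ n = 1 := by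
    intro σ
    have h3 : (σ r) ^ n = r ^ n := by rw [← map_pow, hc, AlgEquiv.commutes]
    have h4 : ((σ r : F) : ℂ) ^ n = (r : ℂ) ^ n := congrArg Subtype.val h3
    rw [div_pow, h4, div_self (pow_ne_zero _ hrC)]
  have hmul : ∀ σ τ : F ≃ₐ[K] F, (((σ * τ) r : F) : ℂ) / r =
      ((σ r : F) : ℂ) / r * (((τ r : F) : ℂ) / r) := by
    intro σ τ
    obtain ⟨z, hz⟩ : ∃ z : K, (z : ℂ) = ((τ r : F) : ℂ) / r := ⟨⟨_, hroots _ (hpow τ)⟩, rfl⟩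
    have h1 : τ r = algebraMap K F z * r := by
      apply Subtype.ext
      change ((τ r : F) : ℂ) = (z : ℂ) * r
      rw [hz, div_mul_cancel₀ _ hrC]
    have h2 : (σ * τ) r = algebraMap K F z * σ r := by
      rw [AlgEquiv.mul_apply, h1, map_mul, AlgEquiv.commutes]
    have h3 : (((σ * τ) r : F) : ℂ) = (z : ℂ) * (σ r : F) := congrArg Subtype.val h2
    rw [h3, hz]; field_simp
  let f : (F ≃ₐ[K] F) →* ℂˣ := MonoidHom.mk' (fun σ => Units.mk0 _ (hσ0 σ)) (fun σ τ => by
    ext; exact hmul σ τ)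
  refine ⟨f.codRestrict _ (fun σ => by
    rw [mem_rootsOfUnity]; ext; exact hpow σ), fun σ => ?_⟩
  change _ = ((σ r : F) : ℂ) / r * r
  rw [div_mul_cancel₀ _ hrC]

lemma kum_normal {ι : Type} [Fintype ι] (K : IntermediateField ℚ ℂ) (n : ι → ℕ) [∀ k, NeZero (n k)]
    (hroots : ∀ k, ∀ z : ℂ, z ^ n k = 1 → z ∈ K) (r : ι → ℂ) (hr : ∀ k, r k ≠ 0) (c : ι → K)
    (hc : ∀ k, r k ^ n k = c k) :
    IsGalois K (adjoin K (Set.range r)) ∧ FiniteDimensional K (adjoin K (Set.range r)) := by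
  classical
  let p : Polynomial K := ∏ k, (Polynomial.X ^ n k - Polynomial.C (c k))
  have hpk : ∀ k, (Polynomial.X ^ n k - Polynomial.C (c k)) ≠ 0 := fun k =>
    Polynomial.X_pow_sub_C_ne_zero (NeZero.pos _) _
  have hp : p ≠ 0 := Finset.prod_ne_zero_iff.2 fun k _ => hpk k
  have hroot : ∀ z : ℂ, z ∈ p.rootSet ℂ ↔ ∃ k, z ^ n k = c k := by
    intro z
    rw [Polynomial.mem_rootSet_of_ne hp]
    simp only [p, map_prod, Finset.prod_eq_zero_iff, Finset.mem_univ, true_and]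
    simp [sub_eq_zero]
  have hadj : adjoin K (Set.range r) = adjoin K (p.rootSet ℂ) := by
    apply le_antisymm
    · rw [adjoin_le_iff]
      rintro _ ⟨k, rfl⟩
      exact subset_adjoin _ _ ((hroot _).2 ⟨k, hc k⟩)
    · rw [adjoin_le_iff]
      intro z hz
      obtain ⟨k, hk⟩ := (hroot z).1 hz
      have h1 : z / r k ∈ K := by
        apply hroots k
        rw [div_pow, hk, hc, div_self]
        rw [← hc]; exact pow_ne_zero _ (hr k)
      have h2 : z = algebraMap K ℂ ⟨z / r k, h1⟩ * r k := by
        change z = z / r k * r k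
        rw [div_mul_cancel₀ _ (hr k)]
      rw [h2]
      exact mul_mem (IntermediateField.algebraMap_mem _ _) (subset_adjoin _ _ ⟨k, rfl⟩)
  rw [hadj]
  have hs : Polynomial.IsSplittingField K (adjoin K (p.rootSet ℂ)) p :=
    adjoin_rootSet_isSplittingField (IsAlgClosed.splits _)
  have hn : Normal K (adjoin K (p.rootSet ℂ)) := Normal.of_isSplittingField p
  exact ⟨⟨⟩, Polynomial.IsSplittingField.finiteDimensional _ p⟩

lemma kummer_core {ι : Type} [Fintype ι] (N : ℕ) [NeZero N] (n : ι → ℕ) [∀ k, NeZero (n k)]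
    (hnN : ∀ k, n k ∣ N) (K : IntermediateField ℚ ℂ)
    (hfinK : Module.finrank ℚ K = N.totient)
    (hrootsN : ∀ z : ℂ, z ^ N = 1 → z ∈ K)
    (hreal : ∀ y : ℝ, (y : ℂ) ∈ K → ∀ c : ℚ, y ^ N = c → ∃ q : ℚ, y ^ 2 = q)
    (r : ι → ℝ) (hr : ∀ k, 0 < r k)
    (c : ι → ℚ) (hc : ∀ k, r k ^ n k = c k) (d : ι → ℕ)
    (H : ∀ l : ι → ℕ, (∃ q : ℚ, (∏ k, r k ^ l k) ^ 2 = q) → ∀ k, n k ∣ d k * l k) :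
    ∃ e, Module.finrank ℚ ((adjoin K (Set.range fun k => (r k : ℂ))).restrictScalars ℚ) * e =
      (∏ k, n k) * N.totient ∧ e ∣ ∏ k, d k := by
  have hroots : ∀ k, ∀ z : ℂ, z ^ n k = 1 → z ∈ K := by
    intro k z hz
    apply hrootsN
    obtain ⟨t, ht⟩ := hnN k
    rw [ht, pow_mul, hz, one_pow]
  have hrC : ∀ k, (r k : ℂ) ≠ 0 := fun k => by exact_mod_cast (hr k).ne'
  have hcC : ∀ k, (r k : ℂ) ^ n k = ((algebraMap ℚ K (c k) : K) : ℂ) := by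
    intro k
    have : (r k : ℂ) ^ n k = ((c k : ℝ) : ℂ) := by rw [← hc]; push_cast; rfl
    rw [this]; simp
  obtain ⟨hgal, hfd⟩ := kum_normal K n hroots (fun k => (r k : ℂ)) hrC (fun k => algebraMap ℚ K (c k)) hcC
  set F := adjoin K (Set.range fun k => (r k : ℂ)) with hF
  let R : ι → F := fun k => ⟨r k, subset_adjoin _ _ ⟨k, rfl⟩⟩
  choose φ hφ using fun k => kum_hom K F (n k) (hroots k) (R k)
    (fun h => hrC k (congrArg Subtype.val h)) (algebraMap ℚ K (c k)) (Subtype.ext (hcC k))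
  let Φ : (F ≃ₐ[K] F) →* (∀ k, rootsOfUnity (n k) ℂ) := MonoidHom.pi φ
  have hΦ : Function.Injective Φ := by
    intro σ τ h
    have h1 : ∀ k, σ (R k) = τ (R k) := by
      intro k
      apply Subtype.ext
      rw [hφ, hφ]
      have : φ k σ = φ k τ := congrFun h k
      rw [this]
    apply AlgEquiv.coe_toAlgHom_injective
    apply IntermediateField.algHom_ext_of_eq_adjoin K hF
    rintro _ ⟨k, rfl⟩
    exact h1 k
  have hcardH : Nat.card Φ.range = Module.finrank K F := by
    rw [← IsGalois.card_aut_eq_finrank K F]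
    exact (Nat.card_congr (MonoidHom.ofInjective hΦ).toEquiv).symm
  have hcardG : Nat.card (∀ k, rootsOfUnity (n k) ℂ) = ∏ k, n k := by
    rw [Nat.card_pi]
    exact Finset.prod_congr rfl fun k _ => HasEnoughRootsOfUnity.natCard_rootsOfUnity _ _
  have htot : Module.finrank ℚ (F.restrictScalars ℚ) = Module.finrank ℚ K * Module.finrank K F :=
    (Module.finrank_mul_finrank ℚ K F).symm
  refine ⟨Φ.range.index, ?_, ?_⟩
  · rw [htot, hfinK, ← hcardG, ← Subgroup.card_mul_index Φ.range, hcardH]; ring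
  · let f : (∀ k, rootsOfUnity (n k) ℂ) →* (∀ k, rootsOfUnity (n k) ℂ) :=
      MonoidHom.pi fun k => (powMonoidHom (d k)).comp (Pi.evalMonoidHom _ k)
    refine (Subgroup.index_dvd_of_le ?_).trans (idx_dvd n d f (fun x k => rfl))
    rintro _ ⟨g, rfl⟩
    apply sub_of_char
    intro l hl
    have hyK : ((∏ k, r k ^ l k : ℝ) : ℂ) ∈ K := by
      have hfix : ∀ σ : F ≃ₐ[K] F, σ (∏ k, R k ^ l k) = ∏ k, R k ^ l k := by
        intro σ
        have h1 := hl _ ⟨σ, rfl⟩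
        have h2 : ∏ k, (((φ k σ : ℂˣ)) : ℂ) ^ l k = 1 := by
          have := congrArg Units.val h1
          push_cast at this
          exact this
        apply Subtype.ext
        rw [map_prod]
        push_cast
        simp only [map_pow]
        push_cast
        simp only [hφ, mul_pow]
        rw [Finset.prod_mul_distrib, h2, one_mul]
      obtain ⟨q, hq⟩ := IntermediateField.mem_bot.1 ((IsGalois.mem_bot_iff_fixed (F := K) _).2 hfix)
      have h3 := congrArg Subtype.val hq
      have h4 : (q : ℂ) = ((∏ k, r k ^ l k : ℝ) : ℂ) := by
        push_cast at h3 ⊢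
        exact h3
      rw [← h4]; exact q.2
    have hyN : (∏ k, r k ^ l k) ^ N = ((∏ k, c k ^ (l k * (N / n k)) : ℚ) : ℝ) := by
      push_cast
      rw [← Finset.prod_pow]
      refine Finset.prod_congr rfl fun k _ => ?_
      rw [← hc, ← pow_mul, ← pow_mul]
      congr 1
      obtain ⟨t, ht⟩ := hnN k
      rw [ht, Nat.mul_div_cancel_left _ (NeZero.pos _)]; ring
    have hd := H l (hreal _ hyK _ hyN)
    refine Finset.prod_eq_one fun k _ => ?_
    obtain ⟨t, ht⟩ := hd k
    have : (g k : ℂˣ) ^ n k = 1 := (mem_rootsOfUnity _ _).1 (g k).2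
    change (((g k) ^ d k : rootsOfUnity (n k) ℂ) : ℂˣ) ^ l k = 1
    push_cast
    rw [← pow_mul, ht, pow_mul, this, one_pow]

lemma kummer_main {ι : Type} [Fintype ι] (N : ℕ) [NeZero N] (n : ι → ℕ) [∀ k, NeZero (n k)]
    (hnN : ∀ k, n k ∣ N) (ζ : ℂ) (hζ : IsPrimitiveRoot ζ N) (r : ι → ℝ) (hr : ∀ k, 0 < r k)
    (c : ι → ℚ) (hc : ∀ k, r k ^ n k = c k) (d : ι → ℕ)
    (H : ∀ l : ι → ℕ, (∃ q : ℚ, (∏ k, r k ^ l k) ^ 2 = q) → ∀ k, n k ∣ d k * l k) :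
    ∃ e, Module.finrank ℚ (adjoin ℚ ({ζ} ∪ Set.range fun k => (r k : ℂ))) * e =
      (∏ k, n k) * N.totient ∧ e ∣ ∏ k, d k := by
  have hcyc := cyc_ext N ζ hζ
  have hfinK : Module.finrank ℚ (adjoin ℚ {ζ}) = N.totient :=
    IsCyclotomicExtension.finrank _ (Polynomial.cyclotomic.irreducible_rat (NeZero.pos N))
  have hrootsN : ∀ z : ℂ, z ^ N = 1 → z ∈ adjoin ℚ {ζ} := by
    intro z hz
    obtain ⟨t, -, rfl⟩ := hζ.eq_pow_of_pow_eq_one hz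
    exact pow_mem (mem_adjoin_simple_self ℚ ζ) t
  have hreal := cyc_real N ζ hζ
  rw [← adjoin_adjoin_left]
  exact kummer_core N n hnN _ hfinK hrootsN hreal r hr c hc d H

theorem stmt18 (ν : ℕ) (a : ℚˣ) (b : Fin ν → ℚˣ)
    (ha : (0 : ℚ) < a) (hb : ∀ h, (0 : ℚ) < b h)
    (hindep : ∀ (l0 : ℤ) (l : Fin ν → ℤ),
      a ^ l0 * ∏ h, b h ^ l h = 1 → l0 = 0 ∧ l = 0)
    (hstrong : ∀ (l0 : ℤ) (l : Fin ν → ℤ) (c : ℚˣ), (0 : ℚ) < c → c ≠ 1 →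
      a ^ l0 * ∏ h, b h ^ l h = c →
      (mRoot (c : ℚ) : ℤ) ∣ (mRoot (a : ℚ) : ℤ) * l0 ∧
        ∀ h, (mRoot (c : ℚ) : ℤ) ∣ (mRoot (b h : ℚ) : ℤ) * l h)
    (i j : ℕ) (hi : 0 < i) (hj : 0 < j) :
    ∀ F : IntermediateField ℚ ℂ,
      F = adjoin ℚ
        ({Complex.exp (2 * Real.pi * Complex.I / ((i * j : ℕ) : ℂ)),
           ((((a : ℚ) : ℝ) ^ (((i * j : ℕ) : ℝ))⁻¹ : ℝ) : ℂ)} ∪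
          Set.range fun h : Fin ν => ((((b h : ℚ) : ℝ) ^ (((i : ℕ) : ℝ))⁻¹ : ℝ) : ℂ)) →
      Module.finrank ℚ F ∣ i ^ (ν + 1) * j * Nat.totient (i * j) ∧
      (i ^ (ν + 1) * j * Nat.totient (i * j)) / Module.finrank ℚ F ∣
        2 ^ (ν + 1) * mRoot (a : ℚ) * ∏ h, mRoot (b h : ℚ) := by
  rintro F rfl
  have hij : 0 < i * j := Nat.mul_pos hi hj
  have : NeZero (i * j) := ⟨hij.ne'⟩
  have hrootpow : ∀ (x : ℚ) (n : ℕ), 0 < x → 0 < n → (((x : ℝ) ^ ((n : ℝ))⁻¹ : ℝ)) ^ n = x :=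
    fun x n hx hn => Real.rpow_inv_natCast_pow (by exact_mod_cast hx.le) hn.ne'
  let n : Option (Fin ν) → ℕ := fun o => o.elim (i * j) (fun _ => i)
  let c : Option (Fin ν) → ℚ := fun o => o.elim (a : ℚ) (fun h => (b h : ℚ))
  let m : Option (Fin ν) → ℕ := fun o => o.elim (mRoot (a : ℚ)) (fun h => mRoot (b h : ℚ))
  let r : Option (Fin ν) → ℝ := fun o => ((c o : ℚ) : ℝ) ^ ((n o : ℕ) : ℝ)⁻¹
  have hn : ∀ k, 0 < n k := by rintro (_ | h); exacts [hij, hi]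
  have hcpos : ∀ k, 0 < c k := by rintro (_ | h); exacts [ha, hb h]
  have hnz : ∀ k, NeZero (n k) := fun k => ⟨(hn k).ne'⟩
  have hrpos : ∀ k, 0 < r k := fun k => Real.rpow_pos_of_pos (by exact_mod_cast hcpos k) _
  have hrc : ∀ k, r k ^ n k = c k := fun k => hrootpow _ _ (hcpos k) (hn k)
  have hset : ({Complex.exp (2 * Real.pi * Complex.I / ((i * j : ℕ) : ℂ)),
           ((((a : ℚ) : ℝ) ^ (((i * j : ℕ) : ℝ))⁻¹ : ℝ) : ℂ)} ∪
          Set.range fun h : Fin ν => ((((b h : ℚ) : ℝ) ^ (((i : ℕ) : ℝ))⁻¹ : ℝ) : ℂ)) =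
      {Complex.exp (2 * Real.pi * Complex.I / ((i * j : ℕ) : ℂ))} ∪
        Set.range fun k => (r k : ℂ) := by
    ext z
    simp only [Set.mem_union, Set.mem_insert_iff, Set.mem_singleton_iff, Set.mem_range,
      Option.exists, r, n, c, Option.elim]
    rw [or_assoc, eq_comm (b := ((((a : ℚ) : ℝ) ^ (((i * j : ℕ) : ℝ))⁻¹ : ℝ) : ℂ))]
  have hH : ∀ l : Option (Fin ν) → ℕ, (∃ q : ℚ, (∏ k, r k ^ l k) ^ 2 = q) →
      ∀ k, n k ∣ 2 * m k * l k := by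
    rintro l ⟨q0, hq0⟩
    obtain ⟨q, hqpos, hq⟩ : ∃ q : ℚ, 0 < q ∧ (∏ k, r k ^ l k) ^ 2 = q := by
      refine ⟨q0, ?_, hq0⟩
      have : (0 : ℝ) < q0 := by
        rw [← hq0]; exact pow_pos (Finset.prod_pos fun k _ => pow_pos (hrpos k) _) _
      exact_mod_cast this
    have hrN : ∀ h : Fin ν, (r (some h)) ^ (i * j) = (c (some h) : ℝ) ^ j := by
      intro h
      rw [pow_mul, ← hrc (some h)]
      rfl
    have e1 : (a : ℚ) ^ (2 * l none) * ∏ h, (b h : ℚ) ^ (2 * j * l (some h)) = q ^ (i * j) := by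
      have : (((a : ℚ) ^ (2 * l none) * ∏ h, (b h : ℚ) ^ (2 * j * l (some h)) : ℚ) : ℝ)
          = ((q ^ (i * j) : ℚ) : ℝ) := by
        rw [Rat.cast_pow, ← hq, Fintype.prod_option]
        push_cast
        rw [← pow_mul, mul_pow, ← Finset.prod_pow]
        congr 1
        · rw [← show ((c none : ℚ) : ℝ) = ((a : ℚ) : ℝ) from rfl, ← hrc none, ← pow_mul, ← pow_mul]
          congr 1
          change i * j * _ = _
          ring
        · refine Finset.prod_congr rfl fun h _ => ?_
          rw [← show ((c (some h) : ℚ) : ℝ) = ((b h : ℚ) : ℝ) from rfl, pow_mul, pow_mul,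
            pow_right_comm _ 2 j, ← hrN h]
          simp only [← pow_mul]
          congr 1; ring
      exact_mod_cast this
    have e2 : a ^ ((2 * l none : ℕ) : ℤ) * ∏ h, b h ^ ((2 * j * l (some h) : ℕ) : ℤ)
        = (Units.mk0 q hqpos.ne') ^ (i * j) := by
      ext
      simp only [zpow_natCast]
      push_cast
      exact e1
    by_cases h1 : (Units.mk0 q hqpos.ne') ^ (i * j) = 1
    · rw [h1] at e2
      obtain ⟨h2, h3⟩ := hindep _ _ e2
      rintro (_ | h)
      · have : l none = 0 := by omega
        simp [this]
      · have h4 := congrFun h3 h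
        have h5 : 2 * j * l (some h) = 0 := by simpa using h4
        have : l (some h) = 0 := by
          rcases Nat.mul_eq_zero.1 h5 with h6 | h6
          · omega
          · exact h6
        simp [this]
    · have hval : (((Units.mk0 q hqpos.ne') ^ (i * j) : ℚˣ) : ℚ) = q ^ (i * j) := by simp
      have hdiv : i * j ∣ mRoot (((Units.mk0 q hqpos.ne') ^ (i * j) : ℚˣ) : ℚ) :=
        dvd_mRoot _ q (fun h => h1 (Units.ext h)) _ hqpos hval.symm
      obtain ⟨h2, h3⟩ := hstrong _ _ _ (by rw [hval]; positivity) h1 e2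
      rintro (_ | h)
      · have h4 := hdiv.trans (by exact_mod_cast h2)
        refine h4.trans (dvd_of_eq ?_)
        change mRoot (a : ℚ) * _ = 2 * mRoot (a : ℚ) * _
        ring
      · have h4 := hdiv.trans (by exact_mod_cast h3 h)
        change i ∣ 2 * mRoot (b h : ℚ) * _
        apply Nat.dvd_of_mul_dvd_mul_right hj
        refine h4.trans (dvd_of_eq ?_)
        ring
  obtain ⟨e, he, hed⟩ := kummer_main (i * j) n (by
      rintro (_ | h)
      · exact dvd_rfl
      · exact Dvd.intro _ rfl) _ (Complex.isPrimitiveRoot_exp (i * j) hij.ne') r hrpos c hrc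
      (fun k => 2 * m k) hH
  rw [hset]
  have hprod : ∏ k, n k = i ^ (ν + 1) * j := by
    rw [Fintype.prod_option]
    simp [n, pow_succ]; ring
  rw [hprod] at he
  have hprod2 : ∏ k, 2 * m k = 2 ^ (ν + 1) * mRoot (a : ℚ) * ∏ h, mRoot (b h : ℚ) := by
    rw [Fintype.prod_option]
    simp [m, Finset.prod_mul_distrib, pow_succ]; ring
  rw [hprod2] at hed
  refine ⟨Dvd.intro _ he, ?_⟩
  rw [← he, Nat.mul_div_cancel_left]
  · exact hed
  · apply Nat.pos_of_ne_zero
    intro h0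
    rw [h0, zero_mul] at he
    have : 0 < i ^ (ν + 1) * j * (i * j).totient :=
      Nat.mul_pos (Nat.mul_pos (pow_pos hi _) hj) (Nat.totient_pos.2 hij)
    omega
end
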